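/- arXiv:2204.10538 — 11 statements merged into one kernel-verified Lean document; each statement's English description precedes it below -/
import Mathlib

section
/- Let α, β be real numbers with α + β ≠ 0 and α/(α + β) < 0. Then α + 2β ≠ 0 and 0 < 2(α + β)/(α + 2β) ≤ 1; and setting s = √(2(α + β)/(α + 2β)), r₁ = (√(1 + s) − √(1 − s))/2 and r₂ = (√(1 + s) + √(1 − s))/2, one has 0 < r₁ ≤ r₂, r₁² + r₂² = 1, and ((r₂² − r₁²)/(2·r₁·r₂))² = −α/(2(α + β)). -/
/-- Algebraic content of the classification of CMC flat tori in S³(1) that are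
(αQ₁+βQ₂)-maps: with α+β ≠ 0 and α/(α+β) < 0 one has α+2β ≠ 0,
0 < 2(α+β)/(α+2β) ≤ 1, and the radii r₁, r₂ defined from s = √(2(α+β)/(α+2β))
satisfy 0 < r₁ ≤ r₂, r₁² + r₂² = 1 and ((r₂²−r₁²)/(2r₁r₂))² = −α/(2(α+β)). -/
theorem stmt_1 (α β : ℝ) (hab : α + β ≠ 0) (hneg : α / (α + β) < 0) :
    α + 2 * β ≠ 0 ∧ 0 < 2 * (α + β) / (α + 2 * β) ∧ 2 * (α + β) / (α + 2 * β) ≤ 1 ∧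
    (let s := Real.sqrt (2 * (α + β) / (α + 2 * β));
     let r₁ := (Real.sqrt (1 + s) - Real.sqrt (1 - s)) / 2;
     let r₂ := (Real.sqrt (1 + s) + Real.sqrt (1 - s)) / 2;
     0 < r₁ ∧ r₁ ≤ r₂ ∧ r₁ ^ 2 + r₂ ^ 2 = 1 ∧
       ((r₂ ^ 2 - r₁ ^ 2) / (2 * r₁ * r₂)) ^ 2 = -α / (2 * (α + β))) := by
  obtain ⟨t, ht⟩ : ∃ t, t = -(α / (α + β)) := ⟨_, rfl⟩
  have htpos : 0 < t := by linarith
  have hα : α = -t * (α + β) := by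
    rw [ht]; field_simp
  have hden : α + 2 * β = (α + β) * (2 + t) := by linarith
  have h2t : (2 + t) ≠ 0 := by positivity
  have hq : 2 * (α + β) / (α + 2 * β) = 2 / (2 + t) := by
    rw [hden]; field_simp
  have hr : -α / (2 * (α + β)) = t / 2 := by
    rw [div_eq_div_iff (by simpa using hab) (by norm_num)]; linarith
  refine ⟨by rw [hden]; exact mul_ne_zero hab h2t, ?_⟩
  rw [hq, hr]
  have hq0 : 0 < 2 / (2 + t) := by positivity
  have hq1 : 2 / (2 + t) < 1 := by rw [div_lt_one (by positivity)]; linarith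
  refine ⟨hq0, hq1.le, ?_⟩
  intro s r₁ r₂
  have hs0 : 0 < s := Real.sqrt_pos.mpr hq0
  have hs2 : s ^ 2 = 2 / (2 + t) := Real.sq_sqrt hq0.le
  have hs1 : s < 1 := by nlinarith
  have hu : Real.sqrt (1 + s) ^ 2 = 1 + s := Real.sq_sqrt (by linarith)
  have hv : Real.sqrt (1 - s) ^ 2 = 1 - s := Real.sq_sqrt (by linarith)
  have hlt : Real.sqrt (1 - s) < Real.sqrt (1 + s) :=
    Real.sqrt_lt_sqrt (by linarith) (by linarith)
  have hv0 : 0 ≤ Real.sqrt (1 - s) := Real.sqrt_nonneg _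
  have e1 : r₂ ^ 2 - r₁ ^ 2 = Real.sqrt (1 + s) * Real.sqrt (1 - s) := by
    simp only [r₁, r₂]; ring
  have e2 : 2 * r₁ * r₂ = s := by
    simp only [r₁, r₂]; linear_combination (hu - hv) / 2
  refine ⟨by simp only [r₁]; linarith, by simp only [r₁, r₂]; linarith, ?_, ?_⟩
  · simp only [r₁, r₂]; linear_combination (hu + hv) / 2
  · rw [e1, e2, div_pow, mul_pow, hu, hv]
    have : (1 + s) * (1 - s) = 1 - s ^ 2 := by ring
    rw [this, hs2]
    field_simp
    ring
end

section
/- Let μ ∈ {1, 4, 8} and let λ > √3/3 be a real number. Set λ₂ = (λ − √3)/(√3·λ + 1), λ₃ = −(λ + √3)/(√3·λ − 1), and S_k = μ·(λ^k + λ₂^k + λ₃^k) for k = 1, 2, 3. Then (3μ − 1)·S₁ − S₁·S₂ + S₃ = 0 if and only if λ = √3; moreover S₁ = 0 if and only if λ = √3 (so the unique Chern–Federer member of each family is the unique minimal one). -/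
/-- Cartan hypersurfaces with g = 3 and multiplicity μ ∈ {1, 4, 8}: the
Chern–Federer equation (3μ−1)S₁ − S₁S₂ + S₃ = 0 holds iff λ = √3, and
minimality S₁ = 0 holds iff λ = √3. -/
theorem stmt_4 (μ : ℝ) (hμ : μ = 1 ∨ μ = 4 ∨ μ = 8) (l : ℝ)
    (hl : Real.sqrt 3 / 3 < l) :
    (let l₂ := (l - Real.sqrt 3) / (Real.sqrt 3 * l + 1);
     let l₃ := -((l + Real.sqrt 3) / (Real.sqrt 3 * l - 1));
     let S := fun k : ℕ => μ * (l ^ k + l₂ ^ k + l₃ ^ k);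
     (((3 * μ - 1) * S 1 - S 1 * S 2 + S 3 = 0) ↔ l = Real.sqrt 3) ∧
       ((S 1 = 0) ↔ l = Real.sqrt 3)) := by
  have hs : Real.sqrt 3 ^ 2 = 3 := Real.sq_sqrt (by norm_num)
  have hs0 : 0 < Real.sqrt 3 := Real.sqrt_pos.mpr (by norm_num)
  generalize Real.sqrt 3 = s at *
  intro l₂ l₃ S
  have hl0 : 0 < l := by linarith
  have hd1 : 0 < s * l + 1 := by positivity
  have hd2 : 0 < s * l - 1 := by nlinarith
  have h2 : l₂ * (s * l + 1) = l - s := by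
    exact div_mul_cancel₀ _ hd1.ne'
  have h3 : l₃ * (s * l - 1) = -(l + s) := by
    simp only [l₃]; rw [neg_mul, div_mul_cancel₀ _ hd2.ne']
  have hd : 3 * l ^ 2 - 1 = (s * l + 1) * (s * l - 1) := by linear_combination (-l ^ 2) * hs
  have hdpos : 0 < 3 * l ^ 2 - 1 := by rw [hd]; positivity
  obtain ⟨q, hq⟩ : ∃ q, q * (3 * l ^ 2 - 1) = l ^ 3 - 3 * l :=
    ⟨(l ^ 3 - 3 * l) / (3 * l ^ 2 - 1), div_mul_cancel₀ _ hdpos.ne'⟩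
  have hsum : (l₂ + l₃) * (3 * l ^ 2 - 1) = -8 * l := by
    rw [hd]
    linear_combination (s * l - 1) * h2 + (s * l + 1) * h3 - 2 * l * hs
  have hprod : (l₂ * l₃) * (3 * l ^ 2 - 1) = 3 - l ^ 2 := by
    rw [hd]
    linear_combination (l₃ * (s * l - 1)) * h2 + (l - s) * h3 + hs
  have e1 : l + l₂ + l₃ = 3 * q := by
    apply mul_right_cancel₀ hdpos.ne'
    linear_combination hsum - 3 * hq
  have e2 : l * (l₂ + l₃) + l₂ * l₃ = -3 := by
    apply mul_right_cancel₀ hdpos.ne'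
    linear_combination l * hsum + hprod
  have e3 : l * (l₂ * l₃) = -q := by
    apply mul_right_cancel₀ hdpos.ne'
    linear_combination l * hprod + hq
  have p2 : l ^ 2 + l₂ ^ 2 + l₃ ^ 2 = 9 * q ^ 2 + 6 := by
    linear_combination (l + l₂ + l₃ + 3 * q) * e1 - 2 * e2
  have p3 : l ^ 3 + l₂ ^ 3 + l₃ ^ 3 = 27 * q ^ 3 + 24 * q := by
    linear_combination (l + l₂ + l₃) * p2 + (9 * q ^ 2 + 9) * e1
      - (l + l₂ + l₃) * e2 + 3 * e3
  have S1 : S 1 = μ * (3 * q) := by simp only [S, pow_one, e1]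
  have S2 : S 2 = μ * (9 * q ^ 2 + 6) := by simp only [S, p2]
  have S3 : S 3 = μ * (27 * q ^ 3 + 24 * q) := by simp only [S, p3]
  have hμ0 : μ ≠ 0 := by rcases hμ with h | h | h <;> rw [h] <;> norm_num
  have hq0 : q = 0 ↔ l = s := by
    constructor
    · intro h
      rw [h] at hq
      have h' : (l * (l + s)) * (l - s) = 0 := by linear_combination -hq - l * hs
      have hp : l * (l + s) ≠ 0 := by positivity
      linarith [(mul_eq_zero.mp h').resolve_left hp]
    · intro h
      have h' : q * (3 * l ^ 2 - 1) = 0 := by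
        rw [hq, h]; linear_combination s * hs
      exact (mul_eq_zero.mp h').resolve_right hdpos.ne'
  rw [S1, S2, S3, ← hq0]
  refine ⟨⟨fun h => ?_, fun h => by rw [h]; ring⟩, ⟨fun h => ?_, fun h => by rw [h]; ring⟩⟩
  · have h' : (μ * (21 - 9 * μ + 27 * (1 - μ) * q ^ 2)) * q = 0 := by
      linear_combination h
    refine (mul_eq_zero.mp h').resolve_left (mul_ne_zero hμ0 ?_)
    rcases hμ with h | h | h <;> rw [h] <;> intro h0 <;> nlinarith [sq_nonneg q]
  · simpa [hμ0] using h
end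

section
/- Let λ > √3/3 be a real number. Set λ₂ = (λ − √3)/(√3·λ + 1), λ₃ = −(λ + √3)/(√3·λ − 1), and S_k = 2·(λ^k + λ₂^k + λ₃^k) for k = 1, 2, 3. Then 5·S₁ − S₁·S₂ + S₃ = 0 if and only if (λ² − 3)(3λ³ − 3λ² − 9λ + 1)(3λ³ + 3λ² − 9λ − 1) = 0. -/
/-- The Cartan hypersurface SU(3)/T² ⊂ S⁷(1) (g = 3, multiplicity 2): the
Chern–Federer equation 5S₁ − S₁S₂ + S₃ = 0 holds iff
(λ²−3)(3λ³−3λ²−9λ+1)(3λ³+3λ²−9λ−1) = 0. -/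
theorem stmt_5 (l : ℝ) (hl : Real.sqrt 3 / 3 < l) :
    (let l₂ := (l - Real.sqrt 3) / (Real.sqrt 3 * l + 1);
     let l₃ := -((l + Real.sqrt 3) / (Real.sqrt 3 * l - 1));
     let S := fun k : ℕ => 2 * (l ^ k + l₂ ^ k + l₃ ^ k);
     5 * S 1 - S 1 * S 2 + S 3 = 0) ↔
    (l ^ 2 - 3) * (3 * l ^ 3 - 3 * l ^ 2 - 9 * l + 1)
      * (3 * l ^ 3 + 3 * l ^ 2 - 9 * l - 1) = 0 := by
  have hs : Real.sqrt 3 ^ 2 = 3 := Real.sq_sqrt (by norm_num)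
  have hp : 0 < Real.sqrt 3 := Real.sqrt_pos.mpr (by norm_num)
  generalize Real.sqrt 3 = s at *
  have hl0 : 0 < l := lt_trans (by positivity) hl
  have h1 : s * l + 1 ≠ 0 := by positivity
  have h2' : 0 < s * l - 1 := by nlinarith
  have h2 : s * l - 1 ≠ 0 := h2'.ne'
  have hD : 3 * l ^ 2 - 1 = (s * l + 1) * (s * l - 1) := by linear_combination (-l ^ 2) * hs
  have hD0 : 3 * l ^ 2 - 1 ≠ 0 := by rw [hD]; exact mul_ne_zero h1 h2
  have ha : (s * l + 1) * ((l - s) / (s * l + 1)) = l - s := by field_simp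
  have hb : (s * l - 1) * (-((l + s) / (s * l - 1))) = -(l + s) := by field_simp
  dsimp only
  generalize (l - s) / (s * l + 1) = a at *
  generalize -((l + s) / (s * l - 1)) = b at *
  -- sum and product of the two other curvatures
  have hsum : (3 * l ^ 2 - 1) * (a + b) = -8 * l := by
    rw [hD]
    linear_combination (s * l - 1) * ha + (s * l + 1) * hb - 2 * l * hs
  have hprod : (3 * l ^ 2 - 1) * (a * b) = 3 - l ^ 2 := by
    rw [hD]
    linear_combination (s * l - 1) * b * ha + (l - s) * hb + hs
  have hsum' : a + b = -8 * l / (3 * l ^ 2 - 1) := by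
    rw [eq_div_iff hD0]; linarith
  have hprod' : a * b = (3 - l ^ 2) / (3 * l ^ 2 - 1) := by
    rw [eq_div_iff hD0]; linarith
  have key : 5 * (2 * (l ^ 1 + a ^ 1 + b ^ 1))
      - 2 * (l ^ 1 + a ^ 1 + b ^ 1) * (2 * (l ^ 2 + a ^ 2 + b ^ 2))
      + 2 * (l ^ 3 + a ^ 3 + b ^ 3) =
      (-6 * l / (3 * l ^ 2 - 1) ^ 3) * ((l ^ 2 - 3) * (3 * l ^ 3 - 3 * l ^ 2 - 9 * l + 1)
      * (3 * l ^ 3 + 3 * l ^ 2 - 9 * l - 1)) := by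
    have e : 5 * (2 * (l ^ 1 + a ^ 1 + b ^ 1))
      - 2 * (l ^ 1 + a ^ 1 + b ^ 1) * (2 * (l ^ 2 + a ^ 2 + b ^ 2))
      + 2 * (l ^ 3 + a ^ 3 + b ^ 3) = 10 * (l + (a + b))
      - 4 * (l + (a + b)) * (l ^ 2 + (a + b) ^ 2 - 2 * (a * b))
      + 2 * (l ^ 3 + (a + b) ^ 3 - 3 * (a * b) * (a + b)) := by ring
    rw [e, hsum', hprod']
    clear hsum hprod hsum' hprod' hD e
    generalize hE : 3 * l ^ 2 - 1 = D at *
    field_simp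
    rw [← hE]
    ring
  rw [key]
  have hc : -6 * l / (3 * l ^ 2 - 1) ^ 3 ≠ 0 :=
    div_ne_zero (mul_ne_zero (by norm_num) hl0.ne') (pow_ne_zero 3 hD0)
  exact ⟨fun h => (mul_eq_zero.mp h).resolve_left hc, fun h => by rw [h, mul_zero]⟩
end

section
/- Let λ > 1 be a real number. Set λ₂ = (λ − 1)/(λ + 1), λ₃ = −1/λ, λ₄ = −(λ + 1)/(λ − 1), and S_k = 2·(λ^k + λ₂^k + λ₃^k + λ₄^k) for k = 1, 2, 3. Then 7·S₁ − S₁·S₂ + S₃ = 0 if and only if λ = 1 + √2; moreover S₁ = 0 if and only if λ = 1 + √2 (the unique Chern–Federer member is the unique minimal one). -/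
/-- The homogeneous hypersurface SO(5)/T² ⊂ S⁹(1) (g = 4, all multiplicities 2):
the Chern–Federer equation 7S₁ − S₁S₂ + S₃ = 0 holds iff λ = 1 + √2, and
minimality S₁ = 0 holds iff λ = 1 + √2. -/
theorem stmt_6 (l : ℝ) (hl : 1 < l) :
    (let l₂ := (l - 1) / (l + 1);
     let l₃ := -(1 / l);
     let l₄ := -((l + 1) / (l - 1));
     let S := fun k : ℕ => 2 * (l ^ k + l₂ ^ k + l₃ ^ k + l₄ ^ k);
     ((7 * S 1 - S 1 * S 2 + S 3 = 0) ↔ l = 1 + Real.sqrt 2) ∧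
       ((S 1 = 0) ↔ l = 1 + Real.sqrt 2)) := by
  intro l₂ l₃ l₄ S
  have h0 : l ≠ 0 := by linarith
  have h1 : l - 1 ≠ 0 := by linarith
  have h2 : l + 1 ≠ 0 := by linarith
  have e13 : l * l₃ = -1 := by simp only [l₃]; field_simp
  have e24 : l₂ * l₄ = -1 := by simp only [l₂, l₄]; field_simp
  have exy : (l + l₃) * (l₂ + l₄) = -4 := by
    simp only [l₂, l₃, l₄]; field_simp; ring
  have hS1 : S 1 = 2 * (l + l₂ + l₃ + l₄) := by simp only [S]; ring
  have hkey : 7 * S 1 - S 1 * S 2 + S 3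
      = -2 * (l + l₂ + l₃ + l₄) * ((l + l₂ + l₃ + l₄) ^ 2 + 2) := by
    simp only [S]
    clear_value l₂ l₃ l₄
    grind
  have hprod : (l + l₂ + l₃ + l₄) * (l * (l - 1) * (l + 1))
      = (l ^ 2 - 2 * l - 1) * (l ^ 2 + 2 * l - 1) := by
    simp only [l₂, l₃, l₄]; field_simp; ring
  have hs : (l + l₂ + l₃ + l₄ = 0) ↔ l = 1 + Real.sqrt 2 := by
    have hq : Real.sqrt 2 ^ 2 = 2 := Real.sq_sqrt (by norm_num)
    have hq0 := Real.sqrt_nonneg 2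
    constructor
    · intro h
      rw [h, zero_mul] at hprod
      have hpos : l ^ 2 + 2 * l - 1 ≠ 0 := by nlinarith
      have h3 : l ^ 2 - 2 * l - 1 = 0 := by
        rcases mul_eq_zero.mp hprod.symm with h | h
        · exact h
        · exact absurd h hpos
      have h4 : (l - 1 - Real.sqrt 2) * (l - 1 + Real.sqrt 2) = 0 := by linarith
      rcases mul_eq_zero.mp h4 with h | h <;> linarith
    · intro h
      have h3 : l ^ 2 - 2 * l - 1 = 0 := by rw [h]; linarith
      rw [h3, zero_mul] at hprod
      exact (mul_eq_zero.mp hprod).resolve_right (mul_ne_zero (mul_ne_zero h0 h1) h2)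
  constructor
  · rw [hkey, ← hs]
    have : (l + l₂ + l₃ + l₄) ^ 2 + 2 ≠ 0 := by positivity
    simp [this]
  · rw [hS1, ← hs]
    simp
end

section
/- Let λ > 1 be a real number. Set λ₂ = (λ − 1)/(λ + 1), λ₃ = −1/λ, λ₄ = −(λ + 1)/(λ − 1), and S_k = 4·(λ^k + λ₃^k) + 5·(λ₂^k + λ₄^k) for k = 1, 2, 3. Then 17·S₁ − S₁·S₂ + S₃ = 0 if and only if 3λ¹² − 40λ¹⁰ + 223λ⁸ − 692λ⁶ + 223λ⁴ − 40λ² + 3 = 0. -/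
/-- The homogeneous hypersurface U(5)/(SU(2)×SU(2)×U(1)) ⊂ S¹⁹(1) (g = 4,
multiplicities 4, 5, 4, 5): the Chern–Federer equation 17S₁ − S₁S₂ + S₃ = 0 holds
iff 3λ¹² − 40λ¹⁰ + 223λ⁸ − 692λ⁶ + 223λ⁴ − 40λ² + 3 = 0. -/
theorem stmt_7 (l : ℝ) (hl : 1 < l) :
    (let l₂ := (l - 1) / (l + 1);
     let l₃ := -(1 / l);
     let l₄ := -((l + 1) / (l - 1));
     let S := fun k : ℕ => 4 * (l ^ k + l₃ ^ k) + 5 * (l₂ ^ k + l₄ ^ k);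
     17 * S 1 - S 1 * S 2 + S 3 = 0) ↔
    3 * l ^ 12 - 40 * l ^ 10 + 223 * l ^ 8 - 692 * l ^ 6 + 223 * l ^ 4
      - 40 * l ^ 2 + 3 = 0 := by
  have h0 : l ≠ 0 := by linarith
  have h1 : l - 1 ≠ 0 := by linarith
  have h2 : l + 1 ≠ 0 := by linarith
  have key : (let l₂ := (l - 1) / (l + 1);
     let l₃ := -(1 / l);
     let l₄ := -((l + 1) / (l - 1));
     let S := fun k : ℕ => 4 * (l ^ k + l₃ ^ k) + 5 * (l₂ ^ k + l₄ ^ k);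
     17 * S 1 - S 1 * S 2 + S 3) =
     (-4 / (l ^ 3 * (l - 1) ^ 3 * (l + 1) ^ 3)) *
      (3 * l ^ 12 - 40 * l ^ 10 + 223 * l ^ 8 - 692 * l ^ 6 + 223 * l ^ 4
      - 40 * l ^ 2 + 3) := by
    simp only []
    field_simp
    ring
  have hc : -4 / (l ^ 3 * (l - 1) ^ 3 * (l + 1) ^ 3) ≠ 0 :=
    div_ne_zero (by norm_num)
      (mul_ne_zero (mul_ne_zero (pow_ne_zero _ h0) (pow_ne_zero _ h1)) (pow_ne_zero _ h2))
  simp only [] at key ⊢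
  rw [key, mul_eq_zero]
  exact or_iff_right hc
end

section
/- Let λ > 1 be a real number. Set λ₂ = (λ − 1)/(λ + 1), λ₃ = −1/λ, λ₄ = −(λ + 1)/(λ − 1), and S_k = 9·(λ^k + λ₃^k) + 6·(λ₂^k + λ₄^k) for k = 1, 2, 3. Then 29·S₁ − S₁·S₂ + S₃ = 0 if and only if 12λ¹² − 111λ¹⁰ + 488λ⁸ − 1098λ⁶ + 488λ⁴ − 111λ² + 12 = 0. -/
/-- The homogeneous hypersurface U(1)·Spin(10)/(S¹·Spin(6)) ⊂ S³¹(1) (g = 4,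
multiplicities 9, 6, 9, 6): the Chern–Federer equation 29S₁ − S₁S₂ + S₃ = 0 holds
iff 12λ¹² − 111λ¹⁰ + 488λ⁸ − 1098λ⁶ + 488λ⁴ − 111λ² + 12 = 0. -/
theorem stmt_8 (l : ℝ) (hl : 1 < l) :
    (let l₂ := (l - 1) / (l + 1);
     let l₃ := -(1 / l);
     let l₄ := -((l + 1) / (l - 1));
     let S := fun k : ℕ => 9 * (l ^ k + l₃ ^ k) + 6 * (l₂ ^ k + l₄ ^ k);
     29 * S 1 - S 1 * S 2 + S 3 = 0) ↔
    12 * l ^ 12 - 111 * l ^ 10 + 488 * l ^ 8 - 1098 * l ^ 6 + 488 * l ^ 4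
      - 111 * l ^ 2 + 12 = 0 := by
  have h0 : l ≠ 0 := by linarith
  have h1 : l - 1 ≠ 0 := by
    intro h
    linarith
  have h2 : l + 1 ≠ 0 := by
    intro h
    linarith
  have key : 29 * (9 * (l ^ 1 + (-(1 / l)) ^ 1)
          + 6 * (((l - 1) / (l + 1)) ^ 1 + (-((l + 1) / (l - 1))) ^ 1))
        - (9 * (l ^ 1 + (-(1 / l)) ^ 1)
          + 6 * (((l - 1) / (l + 1)) ^ 1 + (-((l + 1) / (l - 1))) ^ 1))
        * (9 * (l ^ 2 + (-(1 / l)) ^ 2)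
          + 6 * (((l - 1) / (l + 1)) ^ 2 + (-((l + 1) / (l - 1))) ^ 2))
        + (9 * (l ^ 3 + (-(1 / l)) ^ 3)
          + 6 * (((l - 1) / (l + 1)) ^ 3 + (-((l + 1) / (l - 1))) ^ 3))
      = (-6 / (l * (l - 1) * (l + 1)) ^ 3) *
        (12 * l ^ 12 - 111 * l ^ 10 + 488 * l ^ 8 - 1098 * l ^ 6 + 488 * l ^ 4
          - 111 * l ^ 2 + 12) := by
    field_simp
    ring
  have hc : -6 / (l * (l - 1) * (l + 1)) ^ 3 ≠ 0 :=
    div_ne_zero (by norm_num) (pow_ne_zero _ (mul_ne_zero (mul_ne_zero h0 h1) h2))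
  show _ = (0 : ℝ) ↔ _
  rw [key, mul_eq_zero]
  exact or_iff_right hc
end

section
/- Let m ≥ 2 be an integer and λ > 1 a real number. Set λ₂ = (λ − 1)/(λ + 1), λ₃ = −1/λ, λ₄ = −(λ + 1)/(λ − 1), and S_k = 2·(λ^k + λ₃^k) + (2m − 3)·(λ₂^k + λ₄^k) for k = 1, 2, 3. Then (4m − 3)·S₁ − S₁·S₂ + S₃ = 0 if and only if λ¹² − 4(2m − 1)λ¹⁰ + (72m − 85)λ⁸ − 32(4m² − 10m + 7)λ⁶ + (72m − 85)λ⁴ − 4(2m − 1)λ² + 1 = 0. -/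
/-- The homogeneous hypersurface S(U(2)×U(m))/S(U(1)×U(1)×U(m−2)) ⊂ S^{4m−1}(1)
(g = 4, multiplicities 2, 2m−3, 2, 2m−3): the Chern–Federer equation
(4m−3)S₁ − S₁S₂ + S₃ = 0 holds iff
λ¹² − 4(2m−1)λ¹⁰ + (72m−85)λ⁸ − 32(4m²−10m+7)λ⁶ + (72m−85)λ⁴ − 4(2m−1)λ² + 1 = 0. -/
theorem stmt_9 (m : ℕ) (hm : 2 ≤ m) (l : ℝ) (hl : 1 < l) :
    (let l₂ := (l - 1) / (l + 1);
     let l₃ := -(1 / l);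
     let l₄ := -((l + 1) / (l - 1));
     let S := fun k : ℕ =>
       2 * (l ^ k + l₃ ^ k) + (2 * (m : ℝ) - 3) * (l₂ ^ k + l₄ ^ k);
     (4 * (m : ℝ) - 3) * S 1 - S 1 * S 2 + S 3 = 0) ↔
    l ^ 12 - 4 * (2 * (m : ℝ) - 1) * l ^ 10 + (72 * (m : ℝ) - 85) * l ^ 8
      - 32 * (4 * (m : ℝ) ^ 2 - 10 * (m : ℝ) + 7) * l ^ 6
      + (72 * (m : ℝ) - 85) * l ^ 4 - 4 * (2 * (m : ℝ) - 1) * l ^ 2 + 1 = 0 := by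
  have h0 : l ≠ 0 := by intro h; linarith
  have h1 : l - 1 ≠ 0 := by intro h; linarith
  have h2 : l + 1 ≠ 0 := by intro h; linarith
  have hc : (-2 / (l ^ 3 * (l - 1) ^ 3 * (l + 1) ^ 3)) ≠ 0 := by positivity
  rw [← mul_right_inj' hc (b := (l ^ 12 - 4 * (2 * (m : ℝ) - 1) * l ^ 10 + (72 * (m : ℝ) - 85) * l ^ 8
      - 32 * (4 * (m : ℝ) ^ 2 - 10 * (m : ℝ) + 7) * l ^ 6
      + (72 * (m : ℝ) - 85) * l ^ 4 - 4 * (2 * (m : ℝ) - 1) * l ^ 2 + 1))]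
  rw [mul_zero]
  refine Eq.congr ?_ rfl
  dsimp only
  field_simp
  ring
end

section
/- Let m ≥ 3 be an integer and λ > 1 a real number. Set λ₂ = (λ − 1)/(λ + 1), λ₃ = −1/λ, λ₄ = −(λ + 1)/(λ − 1), and S_k = (λ^k + λ₃^k) + (m − 2)·(λ₂^k + λ₄^k) for k = 1, 2, 3. Then (2m − 3)·S₁ − S₁·S₂ + S₃ = 0 if and only if (2m − 3)λ⁸ − 4(5m − 9)λ⁶ + 2(16m² − 62m + 63)λ⁴ − 4(5m − 9)λ² + (2m − 3) = 0. -/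
/-- The homogeneous hypersurface (SO(2)×SO(m))/(ℤ₂×SO(m−2)) ⊂ S^{2m−1}(1)
(g = 4, multiplicities 1, m−2, 1, m−2): the Chern–Federer equation
(2m−3)S₁ − S₁S₂ + S₃ = 0 holds iff
(2m−3)λ⁸ − 4(5m−9)λ⁶ + 2(16m²−62m+63)λ⁴ − 4(5m−9)λ² + (2m−3) = 0. -/
theorem stmt_10 (m : ℕ) (hm : 3 ≤ m) (l : ℝ) (hl : 1 < l) :
    (let l₂ := (l - 1) / (l + 1);
     let l₃ := -(1 / l);
     let l₄ := -((l + 1) / (l - 1));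
     let S := fun k : ℕ =>
       (l ^ k + l₃ ^ k) + ((m : ℝ) - 2) * (l₂ ^ k + l₄ ^ k);
     (2 * (m : ℝ) - 3) * S 1 - S 1 * S 2 + S 3 = 0) ↔
    (2 * (m : ℝ) - 3) * l ^ 8 - 4 * (5 * (m : ℝ) - 9) * l ^ 6
      + 2 * (16 * (m : ℝ) ^ 2 - 62 * (m : ℝ) + 63) * l ^ 4
      - 4 * (5 * (m : ℝ) - 9) * l ^ 2 + (2 * (m : ℝ) - 3) = 0 := by
  have h0 : l ≠ 0 := (zero_lt_one.trans hl).ne'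
  have h1 : l - 1 ≠ 0 := (sub_pos.mpr hl).ne'
  have h2 : l + 1 ≠ 0 := (by linarith : (0:ℝ) < l + 1).ne'
  have hk : 2 / (l * ((l - 1) * (l + 1)) ^ 3) ≠ 0 := by positivity
  refine Iff.trans ?_ (mul_eq_zero_iff_left hk)
  dsimp only
  apply Eq.congr _ rfl
  field_simp
  ring
end

section
/- Let m ≥ 2 be an integer and λ > 1 a real number. Set λ₂ = (λ − 1)/(λ + 1), λ₃ = −1/λ, λ₄ = −(λ + 1)/(λ − 1), and S_k = 4·(λ^k + λ₃^k) + (4m − 5)·(λ₂^k + λ₄^k) for k = 1, 2, 3. Then (8m − 3)·S₁ − S₁·S₂ + S₃ = 0 if and only if 3λ¹² − 16m·λ¹⁰ + (136m − 117)λ⁸ − 4(64m² − 116m + 63)λ⁶ + (136m − 117)λ⁴ − 16m·λ² + 3 = 0. -/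
/-- The homogeneous hypersurface (Sp(2)×Sp(m))/(Sp(1)×Sp(1)×Sp(m−2)) ⊂ S^{8m−1}(1)
(g = 4, multiplicities 4, 4m−5, 4, 4m−5): the Chern–Federer equation
(8m−3)S₁ − S₁S₂ + S₃ = 0 holds iff
3λ¹² − 16mλ¹⁰ + (136m−117)λ⁸ − 4(64m²−116m+63)λ⁶ + (136m−117)λ⁴ − 16mλ² + 3 = 0. -/
theorem stmt_11 (m : ℕ) (hm : 2 ≤ m) (l : ℝ) (hl : 1 < l) :
    (let l₂ := (l - 1) / (l + 1);
     let l₃ := -(1 / l);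
     let l₄ := -((l + 1) / (l - 1));
     let S := fun k : ℕ =>
       4 * (l ^ k + l₃ ^ k) + (4 * (m : ℝ) - 5) * (l₂ ^ k + l₄ ^ k);
     (8 * (m : ℝ) - 3) * S 1 - S 1 * S 2 + S 3 = 0) ↔
    3 * l ^ 12 - 16 * (m : ℝ) * l ^ 10 + (136 * (m : ℝ) - 117) * l ^ 8
      - 4 * (64 * (m : ℝ) ^ 2 - 116 * (m : ℝ) + 63) * l ^ 6
      + (136 * (m : ℝ) - 117) * l ^ 4 - 16 * (m : ℝ) * l ^ 2 + 3 = 0 := by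
  have h0 : l ≠ 0 := by intro h; linarith
  have h1 : l - 1 ≠ 0 := by intro h; linarith
  have h2 : l + 1 ≠ 0 := by intro h; linarith
  have hD : -4 / (l ^ 3 * (l - 1) ^ 3 * (l + 1) ^ 3) ≠ 0 :=
    div_ne_zero (by norm_num) (by positivity)
  dsimp only
  refine Iff.trans (Eq.congr_left ?_) (mul_eq_zero_iff_left hD)
  field_simp
  ring
end

section
/- Let μ ∈ {1, 2} and let λ > √3 be a real number. Set λ₂ = (√3·λ − 1)/(λ + √3), λ₃ = (λ − √3)/(√3·λ + 1), λ₄ = −1/λ, λ₅ = −(λ + √3)/(√3·λ − 1), λ₆ = −(√3·λ + 1)/(λ − √3), and S_k = μ·(λ^k + λ₂^k + λ₃^k + λ₄^k + λ₅^k + λ₆^k) for k = 1, 2, 3. Then (6μ − 1)·S₁ − S₁·S₂ + S₃ = 0 if and only if λ = 2 + √3; moreover S₁ = 0 if and only if λ = 2 + √3 (the unique Chern–Federer member is the unique minimal one). -/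
/-- The homogeneous hypersurfaces SO(4)/(ℤ₂×ℤ₂) ⊂ S⁷(1) (μ = 1) and
G₂/T² ⊂ S¹³(1) (μ = 2) with g = 6 distinct principal curvatures of multiplicity μ:
the Chern–Federer equation (6μ−1)S₁ − S₁S₂ + S₃ = 0 holds iff λ = 2 + √3, and
minimality S₁ = 0 holds iff λ = 2 + √3. -/
theorem stmt_12 (μ : ℝ) (hμ : μ = 1 ∨ μ = 2) (l : ℝ) (hl : Real.sqrt 3 < l) :
    (let l₂ := (Real.sqrt 3 * l - 1) / (l + Real.sqrt 3);
     let l₃ := (l - Real.sqrt 3) / (Real.sqrt 3 * l + 1);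
     let l₄ := -(1 / l);
     let l₅ := -((l + Real.sqrt 3) / (Real.sqrt 3 * l - 1));
     let l₆ := -((Real.sqrt 3 * l + 1) / (l - Real.sqrt 3));
     let S := fun k : ℕ =>
       μ * (l ^ k + l₂ ^ k + l₃ ^ k + l₄ ^ k + l₅ ^ k + l₆ ^ k);
     (((6 * μ - 1) * S 1 - S 1 * S 2 + S 3 = 0) ↔ l = 2 + Real.sqrt 3) ∧
       ((S 1 = 0) ↔ l = 2 + Real.sqrt 3)) := by
  obtain ⟨s, hs⟩ : ∃ s, s = Real.sqrt 3 := ⟨_, rfl⟩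
  have hs2 : s ^ 2 = 3 := by rw [hs]; norm_num
  have hs0 : 0 < s := by rw [hs]; positivity
  rw [← hs] at hl ⊢
  have hs1 : 1 < s := by nlinarith
  have hl0 : 0 < l := by linarith
  have h1 : 0 < l + s := by linarith
  have h2 : 0 < s * l + 1 := by positivity
  have h3 : 0 < s * l - 1 := by nlinarith
  have h4 : 0 < l - s := by linarith
  obtain ⟨y, hy⟩ : ∃ y, y = (l ^ 2 - 1) / (2 * l) := ⟨_, rfl⟩
  have hyl : 2 * l * y = l ^ 2 - 1 := by rw [hy]; field_simp
  have hy1 : 0 < s * y - 1 := by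
    have : 2 * l * (s * y - 1) = (s * l + 1) * (l - s) := by
      linear_combination s * hyl + l * hs2
    have h5 : 0 < 2 * l * (s * y - 1) := by rw [this]; positivity
    exact pos_of_mul_pos_right h5 (by positivity)
  have hy0 : 0 < y := by
    by_contra h
    nlinarith
  have hy2 : 0 < s * y + 1 := by positivity
  have hd : 0 < 3 * y ^ 2 - 1 := by
    have : 3 * y ^ 2 - 1 = (s * y - 1) * (s * y + 1) := by
      linear_combination -y ^ 2 * hs2
    rw [this]; positivity
  have ha : l + -(1 / l) = 2 * y := by rw [hy]; field_simp; ring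
  have hb : (s * l - 1) / (l + s) + -((l + s) / (s * l - 1)) = 2 * ((y - s) / (s * y + 1)) := by
    have e : (s * l - 1) * (l + s) = 2 * l * (s * y + 1) := by
      linear_combination -s * hyl + l * hs2
    have e' : (s * l - 1) ^ 2 - (l + s) ^ 2 = 2 * (2 * l * (y - s)) := by
      linear_combination -2 * hyl + (l ^ 2 - 1) * hs2
    have : (s * l - 1) / (l + s) + -((l + s) / (s * l - 1))
        = ((s * l - 1) ^ 2 - (l + s) ^ 2) / ((s * l - 1) * (l + s)) := by
      field_simp; ring
    rw [this, e, e']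
    field_simp
  have hc : (l - s) / (s * l + 1) + -((s * l + 1) / (l - s)) = 2 * (-(y + s) / (s * y - 1)) := by
    have e : (s * l + 1) * (l - s) = 2 * l * (s * y - 1) := by
      linear_combination -s * hyl - l * hs2
    have e' : (l - s) ^ 2 - (s * l + 1) ^ 2 = 2 * (2 * l * (-(y + s))) := by
      linear_combination 2 * hyl + (1 - l ^ 2) * hs2
    have : (l - s) / (s * l + 1) + -((s * l + 1) / (l - s))
        = ((l - s) ^ 2 - (s * l + 1) ^ 2) / ((s * l + 1) * (l - s)) := by
      field_simp; ring
    rw [this, e, e']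
    field_simp
  have pa : l * -(1 / l) = -1 := by field_simp
  have pb : (s * l - 1) / (l + s) * -((l + s) / (s * l - 1)) = -1 := by field_simp
  have pc : (l - s) / (s * l + 1) * -((s * l + 1) / (l - s)) = -1 := by field_simp
  intro l₂ l₃ l₄ l₅ l₆ S
  change l + l₄ = _ at ha
  change l₂ + l₅ = _ at hb
  change l₃ + l₆ = _ at hc
  change l * l₄ = _ at pa
  change l₂ * l₅ = _ at pb
  change l₃ * l₆ = _ at pc
  have hS : ∀ k, S k = μ * (l ^ k + l₂ ^ k + l₃ ^ k + l₄ ^ k + l₅ ^ k + l₆ ^ k) := fun _ => rfl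
  clear_value S l₂ l₃ l₄ l₅ l₆
  obtain ⟨b, hb'⟩ : ∃ b, b = (y - s) / (s * y + 1) := ⟨_, rfl⟩
  obtain ⟨c, hc'⟩ : ∃ c, c = -(y + s) / (s * y - 1) := ⟨_, rfl⟩
  obtain ⟨x, hx⟩ : ∃ x, x = (y ^ 3 - 3 * y) / (3 * y ^ 2 - 1) := ⟨_, rfl⟩
  rw [← hb'] at hb
  rw [← hc'] at hc
  have kb : b * (s * y + 1) = y - s := by rw [hb']; field_simp
  have kc : c * (s * y - 1) = -(y + s) := by rw [hc', div_mul_cancel₀ _ hy1.ne']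
  have kx : x * (3 * y ^ 2 - 1) = y ^ 3 - 3 * y := by rw [hx, div_mul_cancel₀ _ hd.ne']
  have sbc : (b + c) * (3 * y ^ 2 - 1) = -8 * y := by
    linear_combination (s * y - 1) * kb + (s * y + 1) * kc - (b + c) * y ^ 2 * hs2 - 2 * y * hs2
  have pbc : (b * c) * (3 * y ^ 2 - 1) = 3 - y ^ 2 := by
    linear_combination c * (s * y - 1) * kb + (y - s) * kc - b * c * y ^ 2 * hs2 + hs2
  have q1 : y + b + c = 3 * x := by
    apply mul_right_cancel₀ hd.ne'
    linear_combination sbc - 3 * kx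
  have q2 : y * b + y * c + b * c = -3 := by
    apply mul_right_cancel₀ hd.ne'
    linear_combination y * sbc + pbc
  have q3 : y * b * c = -x := by
    apply mul_right_cancel₀ hd.ne'
    linear_combination y * pbc + kx
  have p1 : S 1 = μ * (6 * x) := by
    rw [hS]
    linear_combination μ * (ha + hb + hc + 2 * q1)
  have sq : ∀ u v w : ℝ, u + v = 2 * w → u * v = -1 → u ^ 2 + v ^ 2 = 4 * w ^ 2 + 2 := by
    intro u v w h h'
    linear_combination (u + v + 2 * w) * h - 2 * h'
  have cu : ∀ u v w : ℝ, u + v = 2 * w → u * v = -1 → u ^ 3 + v ^ 3 = 8 * w ^ 3 + 6 * w := by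
    intro u v w h h'
    have : u ^ 3 + v ^ 3 = (u + v) ^ 3 - 3 * (u * v) * (u + v) := by ring
    rw [this, h, h']; ring
  have p2 : S 2 = μ * (36 * x ^ 2 + 30) := by
    rw [hS]
    linear_combination μ * (sq _ _ _ ha pa + sq _ _ _ hb pb + sq _ _ _ hc pc
      + 4 * (y + b + c + 3 * x) * q1 - 8 * q2)
  have p3 : S 3 = μ * (216 * x ^ 3 + 210 * x) := by
    have n : y ^ 3 + b ^ 3 + c ^ 3 = (y + b + c) ^ 3
      - 3 * (y + b + c) * (y * b + y * c + b * c) + 3 * (y * b * c) := by ring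
    rw [q1, q2, q3] at n
    rw [hS]
    linear_combination μ * (cu _ _ _ ha pa + cu _ _ _ hb pb + cu _ _ _ hc pc + 8 * n + 6 * q1)
  have hx0 : x = 0 ↔ l = 2 + s := by
    constructor
    · intro h
      rw [h] at kx
      have hy3 : y = s := by
        have : (y - s) * (y * (y + s)) = 0 := by linear_combination -kx - y * hs2
        rcases mul_eq_zero.mp this with h | h
        · linarith
        · have : 0 < y * (y + s) := by positivity
          linarith
      rw [hy3] at hyl
      have : (l - (2 + s)) * (l - s + 2) = 0 := by linear_combination -hyl + hs2
      rcases mul_eq_zero.mp this with h | h <;> linarith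
    · intro h
      have hy3 : y = s := by
        have : (2 * l) * y = (2 * l) * s := by
          rw [hyl, h]; linear_combination -hs2
        exact mul_left_cancel₀ (by positivity) this
      rw [hx, hy3]
      have : s ^ 3 - 3 * s = 0 := by linear_combination s * hs2
      rw [this, zero_div]
  rw [← hx0, p1, p2, p3]
  rcases hμ with rfl | rfl
  · refine ⟨⟨fun h => ?_, fun h => by rw [h]; ring⟩, ⟨fun h => by linarith, fun h => by rw [h]; ring⟩⟩
    linear_combination h / 60
  · refine ⟨⟨fun h => ?_, fun h => by rw [h]; ring⟩, ⟨fun h => by linarith, fun h => by rw [h]; ring⟩⟩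
    have : x * (84 + 216 * x ^ 2) = 0 := by linear_combination -h / 2
    rcases mul_eq_zero.mp this with h | h
    · exact h
    · nlinarith [sq_nonneg x]
end

section
/- Let a be a real m×m matrix satisfying Σ_k ε(k)·a(k,i)·a(k,j) = ε(i)·δ_{ij} for all i, j ∈ Fin m, and let b be a real n×n matrix satisfying Σ_γ ε'(γ)·b(γ,α)·b(γ,β) = ε'(α)·δ_{αβ} for all α, β ∈ Fin n. Let h : Fin n → Fin m → Fin m → ℝ satisfy h(α,i,j) = h(α,j,i) for all α, i, j, and define h'(α,i,j) = Σ_{β,k,l} b(α,β)·a(k,i)·a(l,j)·h(β,k,l). Then Q₁(h') = Q₁(h). -/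
/-- Sign sequence ε : Fin m → ℝ of index p. -/
def eps (m p : ℕ) (i : Fin m) : ℝ := if (i : ℕ) < p then -1 else 1

/-- The invariant polynomial Q₁(h) = Σ_{α,i,j} ε'(α)ε(i)ε(j)(h(α,i,j))². -/
def Q₁ (m n p q : ℕ) (h : Fin n → Fin m → Fin m → ℝ) : ℝ :=
  ∑ α : Fin n, ∑ i : Fin m, ∑ j : Fin m,
    eps n q α * eps m p i * eps m p j * (h α i j) ^ 2

theorem sum_sq_inv {n : ℕ} (e : Fin n → ℝ) (c : Fin n → Fin n → ℝ)
    (hc : ∀ i j, ∑ k, e k * c k i * c k j = e i * (if i = j then 1 else 0)) (x : Fin n → ℝ) :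
    ∑ k, e k * (∑ l, c k l * x l) ^ 2 = ∑ k, e k * x k ^ 2 := by
  have h1 : ∀ k, e k * (∑ l, c k l * x l) ^ 2
      = ∑ i, ∑ j, (e k * c k i * c k j) * (x i * x j) := by
    intro k
    rw [sq, Finset.sum_mul_sum, Finset.mul_sum]
    refine Finset.sum_congr rfl fun i _ => ?_
    rw [Finset.mul_sum]
    refine Finset.sum_congr rfl fun j _ => ?_
    ring
  simp_rw [h1]
  rw [Finset.sum_comm]
  refine Finset.sum_congr rfl fun i _ => ?_
  rw [Finset.sum_comm]
  simp_rw [← Finset.sum_mul, hc]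
  simp [sq]

theorem eps_mul_self (m p : ℕ) (i : Fin m) : eps m p i * eps m p i = 1 := by
  unfold eps
  split_ifs <;> norm_num

theorem transpose_orth (m p : ℕ) (a : Matrix (Fin m) (Fin m) ℝ)
    (ha : ∀ i j : Fin m,
      ∑ k : Fin m, eps m p k * a k i * a k j = eps m p i * (if i = j then 1 else 0))
    (i j : Fin m) :
    ∑ k : Fin m, eps m p k * a i k * a j k = eps m p i * (if i = j then 1 else 0) := by
  have h1 : (Matrix.of fun i k => eps m p i * a k i * eps m p k) * a = 1 := by
    ext i j
    have : ∀ k, eps m p i * a k i * eps m p k * a k j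
        = eps m p i * (eps m p k * a k i * a k j) := fun k => by ring
    simp only [Matrix.mul_apply, Matrix.of_apply, this]
    rw [← Finset.mul_sum, ha, ← mul_assoc, eps_mul_self, one_mul, Matrix.one_apply]
  have h0 := mul_eq_one_comm.mp h1
  have h2 := congrArg (fun M : Matrix (Fin m) (Fin m) ℝ => M i j) h0
  simp only [Matrix.mul_apply, Matrix.of_apply, Matrix.one_apply] at h2
  have h3 : ∑ k : Fin m, eps m p k * a i k * a j k
      = (∑ k, a i k * (eps m p k * a j k * eps m p j)) * eps m p j := by
    rw [Finset.sum_mul]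
    refine Finset.sum_congr rfl fun k _ => ?_
    linear_combination (-(eps m p k * a i k * a j k)) * eps_mul_self m p j
  rw [h3, h2]
  split_ifs with hij
  · rw [hij]; ring
  · ring

/-- Q₁ is invariant under the action of O(p, m−p) × O(q, n−q). -/
theorem stmt_13 (m n p q : ℕ) (hp : p ≤ m) (hq : q ≤ n)
    (a : Matrix (Fin m) (Fin m) ℝ)
    (ha : ∀ i j : Fin m,
      ∑ k : Fin m, eps m p k * a k i * a k j = eps m p i * (if i = j then 1 else 0))
    (b : Matrix (Fin n) (Fin n) ℝ)
    (hb : ∀ α β : Fin n,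
      ∑ γ : Fin n, eps n q γ * b γ α * b γ β = eps n q α * (if α = β then 1 else 0))
    (h : Fin n → Fin m → Fin m → ℝ)
    (hsym : ∀ (α : Fin n) (i j : Fin m), h α i j = h α j i) :
    Q₁ m n p q (fun α i j =>
      ∑ β : Fin n, ∑ k : Fin m, ∑ l : Fin m, b α β * a k i * a l j * h β k l)
      = Q₁ m n p q h := by
  have ha2 := transpose_orth m p a ha
  unfold Q₁
  have e1 : ∀ α i j, ∑ β : Fin n, ∑ k : Fin m, ∑ l : Fin m, b α β * a k i * a l j * h β k l
      = ∑ β, b α β * ∑ k, a k i * ∑ l, a l j * h β k l := by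
    intro α i j
    simp only [Finset.mul_sum]
    refine Finset.sum_congr rfl fun β _ => Finset.sum_congr rfl fun k _ =>
      Finset.sum_congr rfl fun l _ => by ring
  simp only [e1]
  calc _ = ∑ i, ∑ j, eps m p i * eps m p j * ∑ α, eps n q α *
        (∑ β, b α β * ∑ k, a k i * ∑ l, a l j * h β k l) ^ 2 := by
        rw [Finset.sum_comm]
        refine Finset.sum_congr rfl fun i _ => ?_
        rw [Finset.sum_comm]
        refine Finset.sum_congr rfl fun j _ => ?_
        rw [Finset.mul_sum]
        exact Finset.sum_congr rfl fun α _ => by ring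
    _ = ∑ i, ∑ j, eps m p i * eps m p j * ∑ α, eps n q α *
        (∑ k, a k i * ∑ l, a l j * h α k l) ^ 2 := by
        refine Finset.sum_congr rfl fun i _ => Finset.sum_congr rfl fun j _ => ?_
        rw [sum_sq_inv (eps n q) b hb]
    _ = ∑ α, ∑ j, eps n q α * eps m p j * ∑ i, eps m p i *
        (∑ k, a k i * ∑ l, a l j * h α k l) ^ 2 := by
        simp only [Finset.mul_sum]
        rw [Finset.sum_comm' (t' := Finset.univ) (s' := fun _ => Finset.univ) (by simp)]
        rw [Finset.sum_congr rfl fun j _ => Finset.sum_comm, Finset.sum_comm]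
        refine Finset.sum_congr rfl fun α _ => Finset.sum_congr rfl fun j _ =>
          Finset.sum_congr rfl fun i _ => ?_
        simp only [← Finset.mul_sum]
        ring
    _ = ∑ α, ∑ j, eps n q α * eps m p j * ∑ i, eps m p i *
        (∑ l, a l j * h α i l) ^ 2 := by
        refine Finset.sum_congr rfl fun α _ => Finset.sum_congr rfl fun j _ => ?_
        rw [sum_sq_inv (eps m p) (fun i k => a k i) ha2]
    _ = ∑ α, ∑ i, eps n q α * eps m p i * ∑ j, eps m p j *
        (∑ l, a l j * h α i l) ^ 2 := by
        refine Finset.sum_congr rfl fun α _ => ?_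
        simp_rw [Finset.mul_sum Finset.univ _ (eps n q α * _)]
        rw [Finset.sum_comm]
        exact Finset.sum_congr rfl fun i _ => Finset.sum_congr rfl fun j _ => by ring
    _ = _ := by
        refine Finset.sum_congr rfl fun α _ => Finset.sum_congr rfl fun i _ => ?_
        rw [sum_sq_inv (eps m p) (fun i k => a k i) ha2, Finset.mul_sum]
        exact Finset.sum_congr rfl fun j _ => by ring
end
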